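/- In the randomized rounding scheme applied to a fractional schedule x̄_1,…,x̄_T, the expected switching cost of the random integral schedule equals the switching cost of the fractional schedule: for every t ∈ {1,…,T}, E[(x_t − x_{t−1})^+] = (x̄_t − x̄_{t−1})^+, and hence E[β Σ_{t=1}^T (x_t − x_{t−1})^+] = β Σ_{t=1}^T (x̄_t − x̄_{t−1})^+ for every β > 0, where (z)^+ = max(z,0). -/

import Mathlib

open Finset MeasureTheory

noncomputable section

/-- `frac x = x − ⌊x⌋`. -/
def fr (x : ℝ) : ℝ := x - (⌊x⌋₊ : ℝ)

/-- `x̄'_{t−1}`: the projection of the previous fractional state `x̄_{t−1}` into the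
interval `[⌊x̄_t⌋, ⌈x̄_t⌉]`. -/
def projPrev (xbar : ℕ → ℝ) (t : ℕ) : ℝ :=
  max (⌊xbar t⌋₊ : ℝ) (min ((⌈xbar t⌉₊ : ℝ)) (xbar (t - 1)))

/-- `p↑_t = (x̄_t − x̄'_{t−1}) / (1 − frac(x̄'_{t−1}))`, where the fractional part of
`x̄'_{t−1}` is taken relative to the interval `[⌊x̄_t⌋, ⌈x̄_t⌉]`, i.e. it equals
`x̄'_{t−1} − ⌊x̄_t⌋` (this coincides with `x̄'_{t−1} − ⌊x̄'_{t−1}⌋` except at the right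
endpoint of the interval). -/
def pUp (xbar : ℕ → ℝ) (t : ℕ) : ℝ :=
  (xbar t - projPrev xbar t) / (1 - (projPrev xbar t - (⌊xbar t⌋₊ : ℝ)))

/-- `p↓_t = (x̄'_{t−1} − x̄_t) / frac(x̄'_{t−1})`, with the fractional part of
`x̄'_{t−1}` taken relative to the interval `[⌊x̄_t⌋, ⌈x̄_t⌉]` as in `pUp`. -/
def pDown (xbar : ℕ → ℝ) (t : ℕ) : ℝ :=
  (projPrev xbar t - xbar t) / (projPrev xbar t - (⌊xbar t⌋₊ : ℝ))

section RandomizedRounding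

variable {Ω : Type*} [MeasurableSpace Ω] {μ : Measure Ω} [IsProbabilityMeasure μ]

/-- A random variable that takes one of two values is integrable. -/
lemma integrable_natCast_of_two_values {Y : Ω → ℕ} (hY : Measurable Y) {a b : ℕ}
    (h : ∀ ω, Y ω = a ∨ Y ω = b) : Integrable (fun ω => (Y ω : ℝ)) μ := by
  refine Integrable.of_bound (C := (max a b : ℕ))
    (measurable_from_top.comp hY).aestronglyMeasurable (.of_forall fun ω => ?_)
  rw [Real.norm_natCast]
  rcases h ω with h | h <;> rw [h] <;> exact_mod_cast (by simp)

lemma measureReal_ne_eq_one_sub {Y : Ω → ℕ} (hY : Measurable Y) (k : ℕ) :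
    μ.real {ω | Y ω ≠ k} = 1 - μ.real {ω | Y ω = k} :=
  probReal_compl_eq_one_sub (hY (measurableSet_singleton k))

lemma measureReal_eq_add_measureReal_eq_succ {Y : Ω → ℕ} (hY : Measurable Y) {n : ℕ}
    (h : ∀ ω, Y ω = n ∨ Y ω = n + 1) :
    μ.real {ω | Y ω = n} + μ.real {ω | Y ω = n + 1} = 1 := by
  have hset : {ω | Y ω = n} = {ω | Y ω ≠ n + 1} := by
    ext ω
    have := h ω
    simp only [Set.mem_ofPred_eq]
    omega
  rw [hset, measureReal_ne_eq_one_sub hY, sub_add_cancel]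

lemma integral_eq_add_measureReal_eq_succ {Y : Ω → ℕ} (hY : Measurable Y) {n : ℕ}
    (h : ∀ ω, Y ω = n ∨ Y ω = n + 1) :
    ∫ ω, (Y ω : ℝ) ∂μ = n + μ.real {ω | Y ω = n + 1} := by
  have hmeas : MeasurableSet {ω | Y ω = n + 1} := hY (measurableSet_singleton (n + 1))
  have hfun : (fun ω => (Y ω : ℝ)) =
      fun ω => (n : ℝ) + {ω | Y ω = n + 1}.indicator 1 ω := by
    ext ω
    rcases h ω with h | h <;> simp [h]
  have hind : Integrable ({ω | Y ω = n + 1}.indicator (1 : Ω → ℝ)) μ :=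
    (integrable_const (1 : ℝ)).indicator hmeas
  rw [hfun, integral_add (integrable_const _) hind,
    integral_indicator_one hmeas]
  simp

/-- If `Z = k` whenever `Y = k`, then the event `Z = k` splits according to
whether `Y = k` already holds. -/
lemma measureReal_eq_of_keep {Y Z : Ω → ℕ} (hY : Measurable Y) (hZ : Measurable Z) {k : ℕ}
    (hkeep : ∀ ω, Y ω = k → Z ω = k) :
    μ.real {ω | Z ω = k} = μ.real {ω | Y ω = k} + μ.real {ω | Y ω ≠ k ∧ Z ω = k} := by
  rw [← measureReal_union]
  · congr 1
    ext ω
    have := hkeep ω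
    simp only [Set.mem_ofPred_eq, Set.mem_union]
    tauto
  · rw [Set.disjoint_left]
    exact fun ω h h' => h'.1 h
  · exact (hY (measurableSet_singleton k)).compl.inter (hZ (measurableSet_singleton k))

lemma natCeil_eq_natFloor_add_one {x : ℝ} (hx : 0 ≤ x) (h : (⌊x⌋₊ : ℝ) ≠ x) :
    ⌈x⌉₊ = ⌊x⌋₊ + 1 := by
  refine le_antisymm (Nat.ceil_le_floor_add_one x) (Nat.lt_ceil.2 ?_)
  exact (Nat.floor_le hx).lt_of_ne h

lemma natCeil_eq_natFloor {x : ℝ} (h : (⌊x⌋₊ : ℝ) = x) : ⌈x⌉₊ = ⌊x⌋₊ := by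
  conv_lhs => rw [← h, Nat.ceil_natCast]

/-- If `Y` rounds `z ≤ x` with mean `z`, then `Y` equals `⌈x⌉₊` with probability the projection of
`z` into `[⌊x⌋₊, ⌈x⌉₊]`, measured from `⌊x⌋₊`. -/
lemma measureReal_eq_natCeil_of_le {Y : Ω → ℕ} (hY : Measurable Y) {x z : ℝ} (hz : 0 ≤ z)
    (hzx : z ≤ x) (hx : (⌊x⌋₊ : ℝ) ≠ x) (h : ∀ ω, Y ω = ⌊z⌋₊ ∨ Y ω = ⌈z⌉₊)
    (hmean : ∫ ω, (Y ω : ℝ) ∂μ = z) :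
    μ.real {ω | Y ω = ⌈x⌉₊} = max (⌊x⌋₊ : ℝ) (min (⌈x⌉₊ : ℝ) z) - ⌊x⌋₊ := by
  have hceil := natCeil_eq_natFloor_add_one (hz.trans hzx) hx
  rw [min_eq_right (hzx.trans (Nat.le_ceil x))]
  rcases le_or_gt z ⌊x⌋₊ with hle | hgt
  · have hempty : {ω | Y ω = ⌈x⌉₊} = ∅ := by
      ext ω
      have h1 : ⌈z⌉₊ ≤ ⌊x⌋₊ := Nat.ceil_le.2 hle
      have h2 := Nat.floor_le_ceil z
      have := h ω
      simp only [Set.mem_ofPred_eq, Set.mem_empty_iff_false, iff_false]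
      omega
    rw [hempty, max_eq_left hle]
    simp
  · have hfz : ⌊z⌋₊ = ⌊x⌋₊ := le_antisymm (Nat.floor_mono hzx) (Nat.le_floor hgt.le)
    have hcz := natCeil_eq_natFloor_add_one hz (by rw [hfz]; exact hgt.ne)
    rw [hcz, hfz] at h
    rw [integral_eq_add_measureReal_eq_succ hY h] at hmean
    rw [hceil, max_eq_right hgt.le]
    linarith

/-- If `Y` rounds `z > x` with mean `z`, then `Y` equals `⌊x⌋₊` with probability one minus the
projection of `z` into `[⌊x⌋₊, ⌈x⌉₊]`, measured from `⌊x⌋₊`. -/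
lemma measureReal_eq_natFloor_of_lt {Y : Ω → ℕ} (hY : Measurable Y) {x z : ℝ} (hx0 : 0 ≤ x)
    (hxz : x < z) (hx : (⌊x⌋₊ : ℝ) ≠ x) (h : ∀ ω, Y ω = ⌊z⌋₊ ∨ Y ω = ⌈z⌉₊)
    (hmean : ∫ ω, (Y ω : ℝ) ∂μ = z) :
    μ.real {ω | Y ω = ⌊x⌋₊} = 1 - (max (⌊x⌋₊ : ℝ) (min (⌈x⌉₊ : ℝ) z) - ⌊x⌋₊) := by
  have hceil := natCeil_eq_natFloor_add_one hx0 hx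
  have hfx := Nat.floor_le hx0
  have hz : 0 ≤ z := hx0.trans hxz.le
  rw [hceil]
  push_cast
  rcases le_or_gt ((⌊x⌋₊ : ℝ) + 1) z with hle | hgt
  · have hempty : {ω | Y ω = ⌊x⌋₊} = ∅ := by
      ext ω
      have h1 : ⌊x⌋₊ + 1 ≤ ⌊z⌋₊ := Nat.le_floor (by exact_mod_cast hle)
      have h2 := Nat.floor_le_ceil z
      have := h ω
      simp only [Set.mem_ofPred_eq, Set.mem_empty_iff_false, iff_false]
      omega
    rw [hempty, min_eq_left hle, max_eq_right (by linarith)]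
    simp
  · have hfz : ⌊z⌋₊ = ⌊x⌋₊ := (Nat.floor_eq_iff hz).2 ⟨by linarith, hgt⟩
    have hcz := natCeil_eq_natFloor_add_one hz (by rw [hfz]; exact (hfx.trans_lt hxz).ne)
    rw [hcz, hfz] at h
    rw [integral_eq_add_measureReal_eq_succ hY h] at hmean
    have hsum := measureReal_eq_add_measureReal_eq_succ (μ := μ) hY h
    rw [min_eq_right hgt.le, max_eq_right (by linarith)]
    linarith

/-- An increasing rounding step preserves the mean. -/
lemma integral_eq_of_le_step {Y Z : Ω → ℕ} (hY : Measurable Y) (hZ : Measurable Z) {x z : ℝ}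
    (hz : 0 ≤ z) (hzx : z ≤ x) (hx : (⌊x⌋₊ : ℝ) ≠ x)
    (hYz : ∀ ω, Y ω = ⌊z⌋₊ ∨ Y ω = ⌈z⌉₊) (hZx : ∀ ω, Z ω = ⌊x⌋₊ ∨ Z ω = ⌈x⌉₊)
    (hmean : ∫ ω, (Y ω : ℝ) ∂μ = z) (hkeep : ∀ ω, Y ω = ⌈x⌉₊ → Z ω = ⌈x⌉₊)
    (hprob : μ.real {ω | Y ω ≠ ⌈x⌉₊ ∧ Z ω = ⌈x⌉₊} =
      (x - max (⌊x⌋₊ : ℝ) (min (⌈x⌉₊ : ℝ) z)) /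
        (1 - (max (⌊x⌋₊ : ℝ) (min (⌈x⌉₊ : ℝ) z) - ⌊x⌋₊)) * μ.real {ω | Y ω ≠ ⌈x⌉₊}) :
    ∫ ω, (Z ω : ℝ) ∂μ = x := by
  have hq := measureReal_eq_natCeil_of_le hY hz hzx hx hYz hmean
  have hstep := measureReal_eq_of_keep (μ := μ) hY hZ hkeep
  have hlt : max (⌊x⌋₊ : ℝ) (min (⌈x⌉₊ : ℝ) z) < ⌊x⌋₊ + 1 :=
    max_lt (lt_add_one _) ((min_le_right _ _).trans_lt (hzx.trans_lt (Nat.lt_floor_add_one x)))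
  rw [hprob, measureReal_ne_eq_one_sub hY, hq, div_mul_cancel₀ _ (by linarith),
    natCeil_eq_natFloor_add_one (hz.trans hzx) hx] at hstep
  rw [natCeil_eq_natFloor_add_one (hz.trans hzx) hx] at hZx
  rw [integral_eq_add_measureReal_eq_succ hZ hZx, hstep]
  ring

/-- A decreasing rounding step preserves the mean. -/
lemma integral_eq_of_lt_step {Y Z : Ω → ℕ} (hY : Measurable Y) (hZ : Measurable Z) {x z : ℝ}
    (hx0 : 0 ≤ x) (hxz : x < z) (hx : (⌊x⌋₊ : ℝ) ≠ x)
    (hYz : ∀ ω, Y ω = ⌊z⌋₊ ∨ Y ω = ⌈z⌉₊) (hZx : ∀ ω, Z ω = ⌊x⌋₊ ∨ Z ω = ⌈x⌉₊)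
    (hmean : ∫ ω, (Y ω : ℝ) ∂μ = z) (hkeep : ∀ ω, Y ω = ⌊x⌋₊ → Z ω = ⌊x⌋₊)
    (hprob : μ.real {ω | Y ω ≠ ⌊x⌋₊ ∧ Z ω = ⌊x⌋₊} =
      (max (⌊x⌋₊ : ℝ) (min (⌈x⌉₊ : ℝ) z) - x) /
        (max (⌊x⌋₊ : ℝ) (min (⌈x⌉₊ : ℝ) z) - ⌊x⌋₊) * μ.real {ω | Y ω ≠ ⌊x⌋₊}) :
    ∫ ω, (Z ω : ℝ) ∂μ = x := by
  have hq := measureReal_eq_natFloor_of_lt hY hx0 hxz hx hYz hmean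
  have hstep := measureReal_eq_of_keep (μ := μ) hY hZ hkeep
  have hfx := (Nat.floor_le hx0).lt_of_ne hx
  have hlt : (⌊x⌋₊ : ℝ) < max (⌊x⌋₊ : ℝ) (min (⌈x⌉₊ : ℝ) z) :=
    lt_max_of_lt_right (lt_min (hfx.trans_le (Nat.le_ceil x)) (hfx.trans hxz))
  rw [hprob, measureReal_ne_eq_one_sub hY, hq, sub_sub_cancel,
    div_mul_cancel₀ _ (by linarith)] at hstep
  rw [natCeil_eq_natFloor_add_one hx0 hx] at hZx
  have hsum := measureReal_eq_add_measureReal_eq_succ (μ := μ) hZ hZx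
  rw [integral_eq_add_measureReal_eq_succ hZ hZx]
  linarith

/-- An increasing step never decreases the rounded state. -/
lemma le_of_keep_natCeil {a b : ℕ} {x z : ℝ} (hzx : z ≤ x)
    (ha : a = ⌊z⌋₊ ∨ a = ⌈z⌉₊) (hb : b = ⌊x⌋₊ ∨ b = ⌈x⌉₊) (hkeep : a = ⌈x⌉₊ → b = ⌈x⌉₊) :
    a ≤ b := by
  have h1 := Nat.floor_mono hzx
  have h2 := Nat.ceil_mono hzx
  have h3 := Nat.floor_le_ceil x
  have h4 := Nat.ceil_le_floor_add_one x
  omega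

/-- A decreasing step never increases the rounded state. -/
lemma le_of_keep_natFloor {a b : ℕ} {x z : ℝ} (hxz : x ≤ z)
    (ha : a = ⌊z⌋₊ ∨ a = ⌈z⌉₊) (hb : b = ⌊x⌋₊ ∨ b = ⌈x⌉₊) (hkeep : a = ⌊x⌋₊ → b = ⌊x⌋₊) :
    b ≤ a := by
  have h1 := Nat.floor_mono hxz
  have h2 := Nat.ceil_mono hxz
  have h3 := Nat.floor_le_ceil x
  have h4 := Nat.ceil_le_floor_add_one x
  omega

end RandomizedRounding

/-- In the randomized rounding scheme applied to a fractional
schedule `x̄_1,…,x̄_T`, the expected switching cost of the random integral schedule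
equals the switching cost of the fractional schedule: for every `t ∈ {1,…,T}`,
`E[(x_t − x_{t−1})⁺] = (x̄_t − x̄_{t−1})⁺`, and hence
`E[β ∑_{t=1}^T (x_t − x_{t−1})⁺] = β ∑_{t=1}^T (x̄_t − x̄_{t−1})⁺` for every `β > 0`. -/
theorem stmt16 {Ω : Type*} [MeasurableSpace Ω]
    (μ : Measure Ω) [IsProbabilityMeasure μ]
    (T m : ℕ)
    (xbar : ℕ → ℝ) (hx0 : xbar 0 = 0)
    (hxm : ∀ t ∈ Finset.Icc 1 T, xbar t ∈ Set.Icc (0 : ℝ) m)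
    (X : ℕ → Ω → ℕ) (hX0 : ∀ ω, X 0 ω = 0) (hmeas : ∀ t, Measurable (X t))
    (hrange : ∀ t ∈ Finset.Icc 1 T, ∀ ω, X t ω = ⌊xbar t⌋₊ ∨ X t ω = ⌈xbar t⌉₊)
    (hkeepUp : ∀ t ∈ Finset.Icc 1 T, xbar (t - 1) ≤ xbar t →
      ∀ ω, X (t - 1) ω = ⌈xbar t⌉₊ → X t ω = ⌈xbar t⌉₊)
    (hprobUp : ∀ t ∈ Finset.Icc 1 T, xbar (t - 1) ≤ xbar t →
      (⌊xbar t⌋₊ : ℝ) ≠ xbar t →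
      (μ {ω | X (t - 1) ω ≠ ⌈xbar t⌉₊ ∧ X t ω = ⌈xbar t⌉₊}).toReal
        = pUp xbar t * (μ {ω | X (t - 1) ω ≠ ⌈xbar t⌉₊}).toReal)
    (hkeepDown : ∀ t ∈ Finset.Icc 1 T, xbar t < xbar (t - 1) →
      ∀ ω, X (t - 1) ω = ⌊xbar t⌋₊ → X t ω = ⌊xbar t⌋₊)
    (hprobDown : ∀ t ∈ Finset.Icc 1 T, xbar t < xbar (t - 1) →
      (⌊xbar t⌋₊ : ℝ) ≠ xbar t →
      (μ {ω | X (t - 1) ω ≠ ⌊xbar t⌋₊ ∧ X t ω = ⌊xbar t⌋₊}).toReal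
        = pDown xbar t * (μ {ω | X (t - 1) ω ≠ ⌊xbar t⌋₊}).toReal) :
    (∀ t ∈ Finset.Icc 1 T,
      ∫ ω, max ((X t ω : ℝ) - (X (t - 1) ω : ℝ)) 0 ∂μ
        = max (xbar t - xbar (t - 1)) 0) ∧
    ∀ β : ℝ, 0 < β →
      ∫ ω, β * ∑ t ∈ Finset.Icc 1 T, max ((X t ω : ℝ) - (X (t - 1) ω : ℝ)) 0 ∂μ
        = β * ∑ t ∈ Finset.Icc 1 T, max (xbar t - xbar (t - 1)) 0 := by
  have hround : ∀ t ≤ T, ∀ ω, X t ω = ⌊xbar t⌋₊ ∨ X t ω = ⌈xbar t⌉₊ := by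
    intro t ht ω
    rcases Nat.eq_zero_or_pos t with rfl | h
    · simp [hX0, hx0]
    · exact hrange t (Finset.mem_Icc.2 ⟨h, ht⟩) ω
  have hnonneg : ∀ t ≤ T, 0 ≤ xbar t := by
    intro t ht
    rcases Nat.eq_zero_or_pos t with rfl | h
    · exact hx0.ge
    · exact (hxm t (Finset.mem_Icc.2 ⟨h, ht⟩)).1
  have hint : ∀ t ≤ T, Integrable (fun ω => (X t ω : ℝ)) μ := fun t ht =>
    integrable_natCast_of_two_values (hmeas t) (hround t ht)
  have hmean : ∀ t ≤ T, ∫ ω, (X t ω : ℝ) ∂μ = xbar t := by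
    intro t
    induction t with
    | zero => simp [hX0, hx0]
    | succ t ih =>
      intro ht
      have htT : t ≤ T := by omega
      have hmem : t + 1 ∈ Finset.Icc 1 T := Finset.mem_Icc.2 ⟨by omega, ht⟩
      by_cases hx : (⌊xbar (t + 1)⌋₊ : ℝ) = xbar (t + 1)
      · have hX : ∀ ω, (X (t + 1) ω : ℝ) = xbar (t + 1) := fun ω => by
          rcases hround _ ht ω with h | h
          · rw [h, hx]
          · rw [h, natCeil_eq_natFloor hx, hx]
        simp [hX]
      · rcases le_or_gt (xbar t) (xbar (t + 1)) with hle | hlt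
        · exact integral_eq_of_le_step (hmeas t) (hmeas _) (hnonneg t htT) hle hx
            (hround t htT) (hround _ ht) (ih htT) (hkeepUp _ hmem hle) (hprobUp _ hmem hle hx)
        · exact integral_eq_of_lt_step (hmeas t) (hmeas _) (hnonneg _ ht) hlt hx
            (hround t htT) (hround _ ht) (ih htT) (hkeepDown _ hmem hlt)
            (hprobDown _ hmem hlt hx)
  have hcost : ∀ t ∈ Finset.Icc 1 T,
      ∫ ω, max ((X t ω : ℝ) - (X (t - 1) ω : ℝ)) 0 ∂μ = max (xbar t - xbar (t - 1)) 0 := by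
    intro t ht
    have htT : t ≤ T := (Finset.mem_Icc.1 ht).2
    have htT' : t - 1 ≤ T := by omega
    rcases le_or_gt (xbar (t - 1)) (xbar t) with hle | hlt
    · have hX : ∀ ω, max ((X t ω : ℝ) - (X (t - 1) ω : ℝ)) 0 = X t ω - X (t - 1) ω :=
        fun ω => max_eq_left (sub_nonneg.2 (Nat.cast_le.2 (le_of_keep_natCeil hle
          (hround _ htT' ω) (hround _ htT ω) (hkeepUp t ht hle ω))))
      simp_rw [hX]
      rw [integral_sub (hint t htT) (hint _ htT'), hmean t htT, hmean _ htT',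
        max_eq_left (sub_nonneg.2 hle)]
    · have hX : ∀ ω, max ((X t ω : ℝ) - (X (t - 1) ω : ℝ)) 0 = 0 :=
        fun ω => max_eq_right (sub_nonpos.2 (Nat.cast_le.2 (le_of_keep_natFloor hlt.le
          (hround _ htT' ω) (hround _ htT ω) (hkeepDown t ht hlt ω))))
      simp_rw [hX]
      rw [integral_zero, max_eq_right (sub_nonpos.2 hlt.le)]
  refine ⟨hcost, fun β _ => ?_⟩
  rw [integral_const_mul, integral_finsetSum, Finset.sum_congr rfl hcost]
  intro t ht
  have htT : t ≤ T := (Finset.mem_Icc.1 ht).2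
  exact ((hint t htT).sub (hint (t - 1) (by omega))).pos_part
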